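/- arXiv:2509.13748 — 2 statements merged into one kernel-verified Lean document; each statement's English description precedes it below -/
import Mathlib

section
/- If y ∈ D^K satisfies equation (A.1) with zero input, i.e. for all k ∈ [K] and t ≥ 0, y_k(t) = −η_k ∫_0^t y_k(s) ds − Σ_{j=1}^J p_{jk} ψ( Σ_{l=1}^K q_{lj} η_l ∫_0^· y_l(s) ds )(t), then y ≡ 0, i.e. y_k(t) = 0 for all k ∈ [K] and t ≥ 0. -/
open MeasureTheory Set Filter

/-- One-sided reflection map: `psi x t = sup_{s ∈ [0,t]} max (-x s) 0`. -/
noncomputable def psi (x : ℝ → ℝ) (t : ℝ) : ℝ :=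
  sSup ((fun s => max (-x s) 0) '' Set.Icc 0 t)

/-- `phi x t = x t + psi x t`. -/
noncomputable def phi (x : ℝ → ℝ) (t : ℝ) : ℝ := x t + psi x t

/-- Càdlàg on `[0,∞)`: right continuous on `[0,∞)`, left limits on `(0,∞)`. -/
def Cadlag (x : ℝ → ℝ) : Prop :=
  (∀ t : ℝ, 0 ≤ t → ContinuousWithinAt x (Set.Ici t) t) ∧
  (∀ t : ℝ, 0 < t → ∃ L : ℝ, Filter.Tendsto x (nhdsWithin t (Set.Iio t)) (nhds L))

/-- Càdlàg on `[0,T]`: right continuous on `[0,T)`, left limits on `(0,T]`. -/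
def CadlagOn (x : ℝ → ℝ) (T : ℝ) : Prop :=
  (∀ t : ℝ, 0 ≤ t → t < T → ContinuousWithinAt x (Set.Ici t) t) ∧
  (∀ t : ℝ, 0 < t → t ≤ T → ∃ L : ℝ, Filter.Tendsto x (nhdsWithin t (Set.Iio t)) (nhds L))

/-- Sup norm of `x` on `[0,T]`. -/
noncomputable def supNorm (x : ℝ → ℝ) (T : ℝ) : ℝ :=
  sSup ((fun t => |x t|) '' Set.Icc 0 T)

/-- `y` is a càdlàg solution of equation (A.1) on `[0,∞)` for input `(ξ, ζ)`. -/
def IsSolA1 {J K : ℕ} (η : Fin K → ℝ) (p : Fin J → Fin K → ℝ) (q : Fin K → Fin J → ℝ)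
    (ξ : Fin J → ℝ → ℝ) (ζ : Fin K → ℝ → ℝ) (y : Fin K → ℝ → ℝ) : Prop :=
  (∀ k, Cadlag (y k)) ∧
  ∀ k, ∀ t : ℝ, 0 ≤ t →
    y k t = ζ k t - η k * (∫ s in (0:ℝ)..t, y k s)
      - ∑ j, p j k *
          psi (fun r => ξ j r + ∑ l, q l j * η l * (∫ s in (0:ℝ)..r, y l s)) t

/-- A right-continuous real function is measurable. -/
theorem measurable_of_continuousWithinAt_Ici {f : ℝ → ℝ}
    (hf : ∀ t, ContinuousWithinAt f (Set.Ici t) t) : Measurable f := by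
  let g : ℕ → ℝ → ℝ := fun n t => (⌊((n : ℝ) + 1) * t⌋ + 1 : ℝ) / ((n : ℝ) + 1)
  have hg : ∀ n, Measurable fun t => f (g n t) := by
    intro n
    have h : Measurable fun m : ℤ => f ((m + 1 : ℝ) / ((n : ℝ) + 1)) := measurable_from_top
    exact h.comp (Int.measurable_floor.comp (measurable_const_mul ((n : ℝ) + 1)))
  refine measurable_of_tendsto_metrizable hg (tendsto_pi_nhds.2 fun t => ?_)
  have hle : ∀ n, t ≤ g n t := by
    intro n
    have hn : (0 : ℝ) < (n : ℝ) + 1 := by positivity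
    have := (Int.lt_floor_add_one (((n : ℝ) + 1) * t)).le
    simp only [g]
    rw [le_div_iff₀ hn]
    linarith
  have hge : ∀ n, g n t ≤ t + 1 / ((n : ℝ) + 1) := by
    intro n
    have hn : (0 : ℝ) < (n : ℝ) + 1 := by positivity
    have := Int.floor_le (((n : ℝ) + 1) * t)
    simp only [g]
    rw [div_le_iff₀ hn, add_mul t, one_div_mul_cancel hn.ne']
    linarith
  have hlim : Tendsto (fun n => g n t) atTop (nhds t) := by
    refine tendsto_of_tendsto_of_tendsto_of_le_of_le tendsto_const_nhds ?_ hle hge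
    simpa using (tendsto_const_nhds (x := t)).add
      (tendsto_one_div_add_atTop_nhds_zero_nat (𝕜 := ℝ))
  exact (hf t).tendsto.comp
    (tendsto_nhdsWithin_iff.2 ⟨hlim, Eventually.of_forall hle⟩)

/-- A càdlàg function is bounded on compact intervals. -/
theorem Cadlag.exists_abs_le {x : ℝ → ℝ} (hx : Cadlag x) (T : ℝ) :
    ∃ C, ∀ t ∈ Set.Icc 0 T, |x t| ≤ C := by
  refine isCompact_Icc.induction_on (p := fun s => ∃ C, ∀ t ∈ s, |x t| ≤ C) ⟨0, by simp⟩ ?_ ?_ ?_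
  · rintro s t hst ⟨C, hC⟩
    exact ⟨C, fun u hu => hC u (hst hu)⟩
  · rintro s t ⟨C, hC⟩ ⟨D, hD⟩
    refine ⟨max C D, fun u hu => ?_⟩
    rcases hu with hu | hu
    · exact (hC u hu).trans (le_max_left _ _)
    · exact (hD u hu).trans (le_max_right _ _)
  · intro t ht
    have hright : ∀ᶠ u in nhdsWithin t (Set.Ici t), |x u| ≤ |x t| + 1 :=
      ((hx.1 t ht.1).abs.tendsto.eventually (gt_mem_nhds (lt_add_one _))).mono fun _ h => h.le
    rcases ht.1.eq_or_lt with h0 | h0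
    · refine ⟨{u | |x u| ≤ |x t| + 1}, ?_, _, fun u hu => hu⟩
      exact nhdsWithin_mono t (fun u hu => h0 ▸ hu.1) hright
    · obtain ⟨L, hL⟩ := hx.2 t h0
      have hleft : ∀ᶠ u in nhdsWithin t (Set.Iio t), |x u| ≤ |L| + 1 :=
        (hL.abs.eventually (gt_mem_nhds (lt_add_one _))).mono fun _ h => h.le
      refine ⟨{u | |x u| ≤ max (|L| + 1) (|x t| + 1)}, ?_, _, fun u hu => hu⟩
      refine mem_nhdsWithin_of_mem_nhds ?_
      rw [← nhdsLT_sup_nhdsGE t]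
      exact ⟨hleft.mono fun u hu => le_trans hu (le_max_left _ _),
        hright.mono fun u hu => le_trans hu (le_max_right _ _)⟩

/-- A càdlàg function is measurable on `[0,∞)`. -/
theorem Cadlag.aestronglyMeasurable {x : ℝ → ℝ} (hx : Cadlag x) :
    AEStronglyMeasurable x (volume.restrict (Set.Ici 0)) := by
  have hm : Measurable fun t => x (max t 0) := by
    refine measurable_of_continuousWithinAt_Ici fun t => ?_
    refine ContinuousWithinAt.comp (t := Set.Ici (max t 0)) (hx.1 _ (le_max_right _ _))
      (by fun_prop) fun u hu => ?_
    exact max_le_max_right 0 (Set.mem_Ici.1 hu)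
  refine hm.aestronglyMeasurable.congr ?_
  filter_upwards [ae_restrict_mem measurableSet_Ici] with t ht
  rw [max_eq_left ht]

/-- A càdlàg function is integrable on compact intervals. -/
theorem Cadlag.intervalIntegrable {x : ℝ → ℝ} (hx : Cadlag x) {T : ℝ} (hT : 0 ≤ T) :
    IntervalIntegrable x volume 0 T := by
  rw [intervalIntegrable_iff_integrableOn_Ioc_of_le hT]
  obtain ⟨C, hC⟩ := hx.exists_abs_le T
  refine IntegrableOn.of_bound (by simp)
    (hx.aestronglyMeasurable.mono_measure
      (Measure.restrict_mono (fun u hu => hu.1.le) le_rfl)) C ?_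
  filter_upwards [ae_restrict_mem measurableSet_Ioc] with t ht
  exact hC t ⟨ht.1.le, ht.2⟩

theorem abs_psi_le {x : ℝ → ℝ} {t M : ℝ} (ht : 0 ≤ t) (hM : ∀ s ∈ Set.Icc 0 t, |x s| ≤ M) :
    |psi x t| ≤ M := by
  have hM0 : 0 ≤ M := (abs_nonneg _).trans (hM 0 ⟨le_rfl, ht⟩)
  have hnn : 0 ≤ psi x t := by
    refine Real.sSup_nonneg ?_
    rintro _ ⟨s, -, rfl⟩
    exact le_max_right _ _
  rw [abs_of_nonneg hnn]
  refine Real.sSup_le ?_ hM0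
  rintro _ ⟨s, hs, rfl⟩
  exact max_le ((neg_le_abs _).trans (hM s hs)) hM0

/-- Integral Grönwall inequality with zero initial value, for right-continuous functions. -/
theorem nonpos_of_le_mul_integral {S : ℝ → ℝ} {C : ℝ} (hS0 : ∀ t, 0 ≤ t → 0 ≤ S t)
    (hSc : ∀ t, 0 ≤ t → ContinuousWithinAt S (Set.Ici t) t)
    (hSm : AEStronglyMeasurable S (volume.restrict (Set.Ici 0)))
    (hSi : ∀ t, 0 ≤ t → IntervalIntegrable S volume 0 t)
    (h : ∀ t, 0 ≤ t → S t ≤ C * ∫ s in (0 : ℝ)..t, S s) :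
    ∀ t, 0 ≤ t → S t ≤ 0 := by
  intro T hT
  have hF0 : ∀ t, 0 ≤ t → 0 ≤ ∫ s in (0 : ℝ)..t, S s := fun t ht =>
    intervalIntegral.integral_nonneg ht fun u hu => hS0 u hu.1
  have hz := norm_le_gronwallBound_of_norm_deriv_right_le
    (f := fun t => ∫ s in (0 : ℝ)..t, S s) (f' := S) (δ := 0) (K := C) (ε := 0) (a := 0) (b := T)
    ?_ ?_ (by simp) ?_ T ⟨hT, le_rfl⟩
  · have hFT : ∫ s in (0 : ℝ)..T, S s = 0 := by
      simpa [gronwallBound_ε0_δ0] using hz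
    simpa [hFT] using h T hT
  · have := intervalIntegral.continuousOn_primitive_interval
      (((intervalIntegrable_iff' (by simp)).1 (hSi T hT)))
    rwa [uIcc_of_le hT] at this
  · intro t ht
    refine intervalIntegral.integral_hasDerivWithinAt_right (hSi t ht.1) (t := Set.Ioi t) ?_
      ((hSc t ht.1).mono Set.Ioi_subset_Ici_self)
    exact ⟨Set.Ici 0, mem_of_superset self_mem_nhdsWithin fun u hu => ht.1.trans (le_of_lt hu), hSm⟩
  · intro t ht
    rw [Real.norm_of_nonneg (hS0 t ht.1), Real.norm_of_nonneg (hF0 t ht.1), add_zero]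
    exact h t ht.1

/-- If `y ∈ D^K` solves equation (A.1) with zero input `(ξ, ζ) ≡ 0`, then `y ≡ 0`. -/
theorem stmt9
    (J K : ℕ) (hJ : 0 < J) (hK : 0 < K)
    (μ : Fin J → ℝ) (hμ : ∀ j, 0 < μ j)
    (η : Fin K → ℝ) (hη : ∀ k, 0 < η k)
    (p : Fin J → Fin K → ℝ) (hp : ∀ j k, 0 ≤ p j k) (hprow : ∀ j, ∑ k, p j k = 1)
    (q : Fin K → Fin J → ℝ) (hq : ∀ k j, 0 ≤ q k j) (hqrow : ∀ k, ∑ j, q k j = 1)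
    (y : Fin K → ℝ → ℝ) (hcad : ∀ k, Cadlag (y k))
    (heq : ∀ k, ∀ t : ℝ, 0 ≤ t →
      y k t = -(η k) * (∫ s in (0:ℝ)..t, y k s)
        - ∑ j, p j k *
            psi (fun r => ∑ l, q l j * η l * (∫ s in (0:ℝ)..r, y l s)) t) :
    ∀ k, ∀ t : ℝ, 0 ≤ t → y k t = 0 := by
  have hSi : ∀ t, 0 ≤ t → IntervalIntegrable (fun s => ∑ k, |y k s|) volume 0 t := by
    intro t ht
    have := IntervalIntegrable.sum Finset.univ
      (f := fun k s => |y k s|) fun k _ => ((hcad k).intervalIntegrable ht).abs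
    simpa only [Finset.sum_fn] using this
  have hle : ∀ t, 0 ≤ t →
      ∑ k, |y k t| ≤ (2 * ∑ k, η k) * ∫ s in (0 : ℝ)..t, ∑ k, |y k s| := by
    intro t ht
    let A : Fin K → ℝ := fun k => ∫ s in (0 : ℝ)..t, |y k s|
    have hA : ∀ k, ∀ r ∈ Set.Icc 0 t, |∫ s in (0 : ℝ)..r, y k s| ≤ A k := by
      intro k r hr
      refine (intervalIntegral.abs_integral_le_integral_abs hr.1).trans ?_
      exact intervalIntegral.integral_mono_interval le_rfl hr.1 hr.2
        (Eventually.of_forall fun s => abs_nonneg _) ((hcad k).intervalIntegrable ht).abs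
    have hpsi : ∀ j, |psi (fun r => ∑ l, q l j * η l * (∫ s in (0:ℝ)..r, y l s)) t|
        ≤ ∑ l, q l j * η l * A l := by
      intro j
      refine abs_psi_le ht fun r hr => (Finset.abs_sum_le_sum_abs _ _).trans ?_
      refine Finset.sum_le_sum fun l _ => ?_
      have h0 := mul_nonneg (hq l j) (hη l).le
      rw [abs_mul, abs_of_nonneg h0]
      exact mul_le_mul_of_nonneg_left (hA l r hr) h0
    have hk : ∀ k, |y k t| ≤ η k * A k + ∑ j, p j k * ∑ l, q l j * η l * A l := by
      intro k
      rw [heq k t ht]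
      refine (abs_sub _ _).trans (add_le_add ?_ ?_)
      · rw [abs_mul, abs_neg, abs_of_pos (hη k)]
        exact mul_le_mul_of_nonneg_left (hA k t ⟨ht, le_rfl⟩) (hη k).le
      · refine (Finset.abs_sum_le_sum_abs _ _).trans (Finset.sum_le_sum fun j _ => ?_)
        rw [abs_mul, abs_of_nonneg (hp j k)]
        exact mul_le_mul_of_nonneg_left (hpsi j) (hp j k)
    have hrouting : ∑ k, ∑ j, p j k * ∑ l, q l j * η l * A l = ∑ k, η k * A k := by
      rw [Finset.sum_comm]
      simp_rw [← Finset.sum_mul, hprow, one_mul]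
      rw [Finset.sum_comm]
      simp_rw [mul_assoc, ← Finset.sum_mul, hqrow, one_mul]
    have hsum : ∫ s in (0 : ℝ)..t, ∑ k, |y k s| = ∑ k, A k :=
      intervalIntegral.integral_finsetSum fun k _ => ((hcad k).intervalIntegrable ht).abs
    have hA0 : ∀ k, 0 ≤ A k := fun k => (abs_nonneg _).trans (hA k t ⟨ht, le_rfl⟩)
    calc ∑ k, |y k t| ≤ ∑ k, (η k * A k + ∑ j, p j k * ∑ l, q l j * η l * A l) :=
          Finset.sum_le_sum fun k _ => hk k
      _ = 2 * ∑ k, η k * A k := by rw [Finset.sum_add_distrib, hrouting]; ring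
      _ ≤ 2 * ∑ k, η k * ∑ l, A l := by
          refine mul_le_mul_of_nonneg_left (Finset.sum_le_sum fun k _ => ?_) zero_le_two
          exact mul_le_mul_of_nonneg_left
            (Finset.single_le_sum (fun l _ => hA0 l) (Finset.mem_univ k)) (hη k).le
      _ = (2 * ∑ k, η k) * ∫ s in (0 : ℝ)..t, ∑ k, |y k s| := by
          rw [hsum, ← Finset.sum_mul, mul_assoc]
  intro k t ht
  have hS := nonpos_of_le_mul_integral (S := fun s => ∑ k, |y k s|)
    (fun s _ => Finset.sum_nonneg fun k _ => abs_nonneg _)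
    (fun s hs => tendsto_finsetSum _ fun k _ => ((hcad k).1 s hs).abs)
    (Finset.aestronglyMeasurable_fun_sum _ fun k _ => (hcad k).aestronglyMeasurable.norm)
    hSi hle t ht
  have hk := Finset.single_le_sum (f := fun k => |y k t|) (fun l _ => abs_nonneg _)
    (Finset.mem_univ k)
  exact abs_nonpos_iff.1 (hk.trans hS)
end

section
/- Fix T > 0 and suppose y, ỹ : [0,T] → ℝ^K are càdlàg and both satisfy, for all k ∈ [K] and all t ∈ [0,T], the equation y_k(t) = ζ_k(t) − η_k ∫_0^t y_k(s) ds − Σ_{j=1}^J p_{jk} ψ( ξ_j + Σ_{l=1}^K q_{lj} η_l ∫_0^· y_l(s) ds )(t), for some fixed (ξ, ζ) ∈ D^{J+K}. Then y(t) = ỹ(t) for all t ∈ [0,T]. -/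
open MeasureTheory Set Filter

open Topology

lemma psi_le_psi_add {x x' : ℝ → ℝ} {t B : ℝ} (ht : 0 ≤ t)
    (h : ∀ s ∈ Icc 0 t, |x s - x' s| ≤ B) : psi x t ≤ psi x' t + B := by
  have hB : 0 ≤ B := (abs_nonneg _).trans (h 0 ⟨le_rfl, ht⟩)
  have key : ∀ s ∈ Icc 0 t, max (-x s) 0 ≤ max (-x' s) 0 + B ∧
      max (-x' s) 0 ≤ max (-x s) 0 + B := by
    intro s hs
    have h1 := abs_le.1 (h s hs)
    refine ⟨max_le ?_ ?_, max_le ?_ ?_⟩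
    · linarith [le_max_left (-x' s) 0]
    · linarith [le_max_right (-x' s) 0]
    · linarith [le_max_left (-x s) 0]
    · linarith [le_max_right (-x s) 0]
  unfold psi
  by_cases hb : BddAbove ((fun s => max (-x' s) 0) '' Icc 0 t)
  · refine csSup_le ((nonempty_Icc.2 ht).image _) ?_
    rintro _ ⟨s, hs, rfl⟩
    exact (key s hs).1.trans (by gcongr; exact le_csSup hb ⟨s, hs, rfl⟩)
  · have hb' : ¬ BddAbove ((fun s => max (-x s) 0) '' Icc 0 t) := by
      rintro ⟨M, hM⟩
      refine hb ⟨M + B, ?_⟩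
      rintro _ ⟨s, hs, rfl⟩
      exact (key s hs).2.trans (by gcongr; exact hM ⟨s, hs, rfl⟩)
    rw [Real.sSup_of_not_bddAbove hb, Real.sSup_of_not_bddAbove hb']
    linarith

/-- The reflection map is 1-Lipschitz for the uniform norm on `[0,t]`. -/
lemma abs_psi_sub_psi_le {x x' : ℝ → ℝ} {t B : ℝ} (ht : 0 ≤ t)
    (h : ∀ s ∈ Icc 0 t, |x s - x' s| ≤ B) : |psi x t - psi x' t| ≤ B := by
  have h1 := psi_le_psi_add ht h
  have h2 := psi_le_psi_add (x := x') (x' := x) ht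
    (fun s hs => by rw [abs_sub_comm]; exact h s hs)
  exact abs_le.2 ⟨by linarith, by linarith⟩

lemma CadlagOn.exists_abs_le {f : ℝ → ℝ} {T : ℝ} (hf : CadlagOn f T) :
    ∃ M, ∀ t ∈ Icc 0 T, |f t| ≤ M := by
  refine isCompact_Icc.induction_on (p := fun s => ∃ M, ∀ t ∈ s, |f t| ≤ M)
    ⟨0, by simp⟩ ?_ ?_ ?_
  · rintro s t hst ⟨M, hM⟩
    exact ⟨M, fun u hu => hM u (hst hu)⟩
  · rintro s t ⟨M, hM⟩ ⟨N, hN⟩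
    refine ⟨max M N, ?_⟩
    rintro u (hu | hu)
    · exact (hM u hu).trans (le_max_left _ _)
    · exact (hN u hu).trans (le_max_right _ _)
  · rintro t ⟨ht0, htT⟩
    have hlim : ∀ {l : Filter ℝ} {L : ℝ}, Tendsto f l (𝓝 L) → ∀ᶠ u in l, |f u| ≤ |L| + 1 :=
      fun h => (h.abs.eventually_lt_const (lt_add_one _)).mono fun _ h => h.le
    have hright : ∃ M, ∀ᶠ u in 𝓝[>] t, u ∈ Icc 0 T → |f u| ≤ M := by
      rcases htT.eq_or_lt with rfl | h
      · refine ⟨0, ?_⟩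
        filter_upwards [self_mem_nhdsWithin] with u hu hu'
        exact absurd hu'.2 (not_le.2 hu)
      · refine ⟨_, (hlim ((hf.1 t ht0 h).mono Ioi_subset_Ici_self)).mono fun u hu _ => hu⟩
    have hleft : ∃ M, ∀ᶠ u in 𝓝[<] t, u ∈ Icc 0 T → |f u| ≤ M := by
      rcases ht0.eq_or_lt with rfl | h
      · refine ⟨0, ?_⟩
        filter_upwards [self_mem_nhdsWithin] with u hu hu'
        exact absurd hu'.1 (not_le.2 hu)
      · obtain ⟨L, hL⟩ := hf.2 t h htT
        exact ⟨_, (hlim hL).mono fun u hu _ => hu⟩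
    obtain ⟨M, hM⟩ := hright
    obtain ⟨N, hN⟩ := hleft
    have hall : ∀ᶠ u in 𝓝 t, u ∈ Icc 0 T → |f u| ≤ max (max M N) |f t| := by
      rw [eventually_nhdsWithin_iff] at hM hN
      filter_upwards [hM, hN] with u hu1 hu2 hu
      rcases lt_trichotomy u t with h | rfl | h
      · exact (hu2 h hu).trans ((le_max_right _ _).trans (le_max_left _ _))
      · exact le_max_right _ _
      · exact (hu1 h hu).trans ((le_max_left _ _).trans (le_max_left _ _))
    exact ⟨{u | |f u| ≤ _}, eventually_nhdsWithin_iff.2 hall, _, fun u hu => hu⟩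

lemma CadlagOn.aemeasurable {f : ℝ → ℝ} {T : ℝ} (hf : CadlagOn f T) :
    AEMeasurable f (volume.restrict (Ico 0 T)) := by
  refine aemeasurable_of_tendsto_metrizable_ae atTop
    (f := fun (n : ℕ) t => f ((⌊((n : ℝ) + 1) * t⌋ + 1) / ((n : ℝ) + 1))) (fun n => ?_) ?_
  · have h1 : Measurable fun t : ℝ => ⌊((n : ℝ) + 1) * t⌋ :=
      Int.measurable_floor.comp (measurable_const_mul _)
    have h2 : Measurable fun m : ℤ => f (((m : ℝ) + 1) / ((n : ℝ) + 1)) :=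
      measurable_from_top
    exact (h2.comp h1).aemeasurable
  · filter_upwards [ae_restrict_mem measurableSet_Ico] with t ht
    have hpos : ∀ n : ℕ, (0 : ℝ) < n + 1 := fun n => by positivity
    have hge : ∀ n : ℕ, t ≤ (⌊((n : ℝ) + 1) * t⌋ + 1) / ((n : ℝ) + 1) := fun n => by
      rw [le_div_iff₀ (hpos n), mul_comm]
      exact (Int.lt_floor_add_one _).le
    have hle : ∀ n : ℕ, (⌊((n : ℝ) + 1) * t⌋ + 1) / ((n : ℝ) + 1) ≤ t + 1 / ((n : ℝ) + 1) :=
      fun n => by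
        rw [add_div]
        gcongr
        rw [div_le_iff₀ (hpos n), mul_comm t]
        exact Int.floor_le _
    refine (hf.1 t ht.1 ht.2).tendsto.comp (tendsto_nhdsWithin_iff.2 ⟨?_, .of_forall hge⟩)
    refine tendsto_of_tendsto_of_tendsto_of_le_of_le tendsto_const_nhds ?_ hge hle
    simpa using tendsto_const_nhds.add (tendsto_one_div_add_atTop_nhds_zero_nat (𝕜 := ℝ))

lemma CadlagOn.integrableOn {f : ℝ → ℝ} {T : ℝ} (hf : CadlagOn f T) :
    IntegrableOn f (Icc 0 T) := by
  obtain ⟨M, hM⟩ := hf.exists_abs_le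
  refine (integrableOn_Icc_iff_integrableOn_Ico).2 ?_
  refine Integrable.of_bound hf.aemeasurable.aestronglyMeasurable M ?_
  filter_upwards [ae_restrict_mem measurableSet_Ico] with t ht
  exact hM t (Ico_subset_Icc_self ht)

/-- Integral form of Grönwall's inequality with zero initial bound. -/
lemma eq_zero_of_le_mul_integral {g : ℝ → ℝ} {T C : ℝ}
    (hint : IntegrableOn g (Icc 0 T))
    (hcont : ∀ t, 0 ≤ t → t < T → ContinuousWithinAt g (Ici t) t)
    (hg : ∀ t ∈ Icc 0 T, 0 ≤ g t) (hle : ∀ t ∈ Icc 0 T, g t ≤ C * ∫ s in (0 : ℝ)..t, g s) :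
    ∀ t ∈ Icc 0 T, g t = 0 := by
  intro t ht
  have hT : 0 ≤ T := ht.1.trans ht.2
  have hnonneg : ∀ t ∈ Icc 0 T, 0 ≤ ∫ s in (0 : ℝ)..t, g s := fun t ht =>
    intervalIntegral.integral_nonneg ht.1 fun s hs => hg s ⟨hs.1, hs.2.trans ht.2⟩
  have hF := norm_le_gronwallBound_of_norm_deriv_right_le (E := ℝ)
    (f := fun t => ∫ s in (0 : ℝ)..t, g s) (f' := g) (δ := 0) (K := C) (ε := 0) (a := 0) (b := T)
    (by
      have := intervalIntegral.continuousOn_primitive_interval (μ := volume) (f := g) (a := 0)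
        (b := T) (by rwa [uIcc_of_le hT])
      rwa [uIcc_of_le hT] at this)
    (fun t ht => by
      refine intervalIntegral.integral_hasDerivWithinAt_right (t := Ioi t) ?_ ?_
        ((hcont t ht.1 ht.2).mono Ioi_subset_Ici_self)
      · rw [intervalIntegrable_iff_integrableOn_Icc_of_le ht.1]
        exact hint.mono_set (Icc_subset_Icc_right ht.2.le)
      · exact ⟨Ioo t T, Ioo_mem_nhdsGT ht.2, (hint.mono_set
          (Ioo_subset_Icc_self.trans (Icc_subset_Icc_left ht.1))).aestronglyMeasurable⟩)
    (by simp)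
    (fun t ht => by
      have ht' := Ico_subset_Icc_self ht
      rw [Real.norm_of_nonneg (hg t ht'), Real.norm_of_nonneg (hnonneg t ht'), add_zero]
      exact hle t ht') t ht
  simp only [gronwallBound_ε0_δ0] at hF
  have h0 := norm_le_zero_iff.1 hF
  have := hle t ht
  rw [h0, mul_zero] at this
  exact le_antisymm this (hg t ht)

/-- Uniqueness on `[0,T]`: two càdlàg solutions of equation (A.1) on `[0,T]` for the same
input `(ξ, ζ) ∈ D^{J+K}` coincide on `[0,T]`. -/
theorem stmt12
    (J K : ℕ) (hJ : 0 < J) (hK : 0 < K)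
    (μ : Fin J → ℝ) (hμ : ∀ j, 0 < μ j)
    (η : Fin K → ℝ) (hη : ∀ k, 0 < η k)
    (p : Fin J → Fin K → ℝ) (hp : ∀ j k, 0 ≤ p j k) (hprow : ∀ j, ∑ k, p j k = 1)
    (q : Fin K → Fin J → ℝ) (hq : ∀ k j, 0 ≤ q k j) (hqrow : ∀ k, ∑ j, q k j = 1)
    (ξ : Fin J → ℝ → ℝ) (hξ : ∀ j, Cadlag (ξ j))
    (ζ : Fin K → ℝ → ℝ) (hζ : ∀ k, Cadlag (ζ k))
    (T : ℝ) (hT : 0 < T)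
    (y y' : Fin K → ℝ → ℝ)
    (hy : ∀ k, CadlagOn (y k) T) (hy' : ∀ k, CadlagOn (y' k) T)
    (heq : ∀ k, ∀ t ∈ Set.Icc (0:ℝ) T,
      y k t = ζ k t - η k * (∫ s in (0:ℝ)..t, y k s)
        - ∑ j, p j k *
            psi (fun r => ξ j r + ∑ l, q l j * η l * (∫ s in (0:ℝ)..r, y l s)) t)
    (heq' : ∀ k, ∀ t ∈ Set.Icc (0:ℝ) T,
      y' k t = ζ k t - η k * (∫ s in (0:ℝ)..t, y' k s)
        - ∑ j, p j k *
            psi (fun r => ξ j r + ∑ l, q l j * η l * (∫ s in (0:ℝ)..r, y' l s)) t) :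
    ∀ k, ∀ t ∈ Set.Icc (0:ℝ) T, y k t = y' k t := by
  have hyi := fun k => (hy k).integrableOn
  have hyi' := fun k => (hy' k).integrableOn
  set d : Fin K → ℝ → ℝ := fun k t => |y k t - y' k t| with hd
  have hdi : ∀ k, IntegrableOn (d k) (Icc 0 T) := fun k => ((hyi k).sub (hyi' k)).abs
  have hii : ∀ {f : ℝ → ℝ} {t : ℝ}, t ∈ Icc 0 T → IntegrableOn f (Icc 0 T) →
      IntervalIntegrable f volume 0 t := fun ht hf => by
    rw [intervalIntegrable_iff_integrableOn_Icc_of_le ht.1]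
    exact hf.mono_set (Icc_subset_Icc_right ht.2)
  set g : ℝ → ℝ := fun t => ∑ k, d k t with hgdef
  have hgi : IntegrableOn g (Icc 0 T) := integrable_finsetSum _ fun k _ => hdi k
  have hg0 : ∀ t, 0 ≤ g t := fun t => Finset.sum_nonneg fun k _ => abs_nonneg _
  have hint : ∀ k, ∀ t ∈ Icc 0 T, ∀ r ∈ Icc 0 t,
      |(∫ s in (0 : ℝ)..r, y k s) - ∫ s in (0 : ℝ)..r, y' k s| ≤ ∫ s in (0 : ℝ)..t, g s := by
    intro k t ht r hr
    have hr' : r ∈ Icc 0 T := ⟨hr.1, hr.2.trans ht.2⟩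
    rw [← intervalIntegral.integral_sub (hii hr' (hyi k)) (hii hr' (hyi' k))]
    calc _ ≤ ∫ s in (0 : ℝ)..r, d k s := intervalIntegral.abs_integral_le_integral_abs hr.1
      _ ≤ ∫ s in (0 : ℝ)..r, g s :=
        intervalIntegral.integral_mono_on hr.1 (hii hr' (hdi k)) (hii hr' hgi) fun s _ =>
          Finset.single_le_sum (f := fun k => d k s) (fun _ _ => abs_nonneg _) (Finset.mem_univ k)
      _ ≤ ∫ s in (0 : ℝ)..t, g s :=
        intervalIntegral.integral_mono_interval le_rfl hr.1 hr.2
          (.of_forall hg0) (hii ht hgi)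
  have hbound : ∀ k, ∀ t ∈ Icc 0 T,
      d k t ≤ (η k + ∑ j, p j k * ∑ l, q l j * η l) * ∫ s in (0 : ℝ)..t, g s := by
    intro k t ht
    have hpsi : ∀ j, |psi (fun r => ξ j r + ∑ l, q l j * η l * (∫ s in (0:ℝ)..r, y l s)) t -
        psi (fun r => ξ j r + ∑ l, q l j * η l * (∫ s in (0:ℝ)..r, y' l s)) t| ≤
        (∑ l, q l j * η l) * ∫ s in (0 : ℝ)..t, g s := by
      intro j
      refine abs_psi_sub_psi_le ht.1 fun r hr => ?_
      rw [add_sub_add_left_eq_sub, ← Finset.sum_sub_distrib, Finset.sum_mul]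
      refine (Finset.abs_sum_le_sum_abs _ _).trans (Finset.sum_le_sum fun l _ => ?_)
      have hc : 0 ≤ q l j * η l := mul_nonneg (hq l j) (hη l).le
      rw [← mul_sub, abs_mul, abs_of_nonneg hc]
      exact mul_le_mul_of_nonneg_left (hint l t ht r hr) hc
    simp only [hd]
    rw [heq k t ht, heq' k t ht, add_mul, Finset.sum_mul]
    have h1 : |η k * (∫ s in (0:ℝ)..t, y k s) - η k * ∫ s in (0:ℝ)..t, y' k s| ≤
        η k * ∫ s in (0 : ℝ)..t, g s := by
      rw [← mul_sub, abs_mul, abs_of_pos (hη k)]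
      exact mul_le_mul_of_nonneg_left (hint k t ht t ⟨ht.1, le_rfl⟩) (hη k).le
    have h2 : |∑ j, p j k *
          psi (fun r => ξ j r + ∑ l, q l j * η l * (∫ s in (0:ℝ)..r, y l s)) t -
        ∑ j, p j k *
          psi (fun r => ξ j r + ∑ l, q l j * η l * (∫ s in (0:ℝ)..r, y' l s)) t| ≤
        ∑ j, p j k * (∑ l, q l j * η l) * ∫ s in (0 : ℝ)..t, g s := by
      rw [← Finset.sum_sub_distrib]
      refine (Finset.abs_sum_le_sum_abs _ _).trans (Finset.sum_le_sum fun j _ => ?_)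
      rw [← mul_sub, abs_mul, abs_of_nonneg (hp j k), mul_assoc]
      exact mul_le_mul_of_nonneg_left (hpsi j) (hp j k)
    rw [abs_le] at h1 h2 ⊢
    constructor <;> linarith [h1.1, h1.2, h2.1, h2.2]
  have hzero := eq_zero_of_le_mul_integral hgi
    (C := ∑ k, (η k + ∑ j, p j k * ∑ l, q l j * η l))
    (fun t h0 hT => by
      have : ∀ k ∈ Finset.univ, ContinuousWithinAt (d k) (Ici t) t := fun k _ =>
        (((hy k).1 t h0 hT).sub ((hy' k).1 t h0 hT)).abs
      exact tendsto_finsetSum _ this)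
    (fun t _ => hg0 t)
    (fun t ht => by
      rw [Finset.sum_mul]
      exact Finset.sum_le_sum fun k _ => hbound k t ht)
  intro k t ht
  have h := (Finset.sum_eq_zero_iff_of_nonneg fun k _ => abs_nonneg _).1 (hzero t ht) k
    (Finset.mem_univ k)
  exact sub_eq_zero.1 (abs_eq_zero.1 h)
end
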